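/- Let A ∈ ℝ^{k×n}, y ∈ ℝ^k, and λ > 0, and let ‖v‖₀ denote the number of nonzero entries of v ∈ ℝ^n. The function f(v) = (1/2λ)‖y − Av‖² + ‖v‖₀ attains its global minimum at some point of ℝ^n. -/

import Mathlib

open Matrix Finset

/-- A linear least-squares problem restricted to a subspace has a solution. -/
theorem Matrix.exists_forall_sum_sq_sub_mulVec_le {m n : Type*} [Fintype m] [Fintype n]
    (A : Matrix m n ℝ) (y : m → ℝ) (W : Submodule ℝ (n → ℝ)) :
    ∃ w ∈ W, ∀ v ∈ W, ∑ i, (y i - A.mulVec w i) ^ 2 ≤ ∑ i, (y i - A.mulVec v i) ^ 2 := by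
  let L : (n → ℝ) →ₗ[ℝ] EuclideanSpace ℝ m :=
    (WithLp.linearEquiv 2 ℝ (m → ℝ)).symm.toLinearMap ∘ₗ A.mulVecLin
  have hdist (v : n → ℝ) :
      dist (WithLp.toLp 2 y) (L v) ^ 2 = ∑ i, (y i - A.mulVec v i) ^ 2 := by
    rw [EuclideanSpace.dist_eq, Real.sq_sqrt (by positivity)]
    simp [L, Real.dist_eq, sq_abs]
  obtain ⟨_, ⟨w, hw, rfl⟩, hmin⟩ :=
    (W.map L).closed_of_finiteDimensional.exists_infDist_eq_dist ⟨0, (W.map L).zero_mem⟩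
      (WithLp.toLp 2 y)
  refine ⟨w, hw, fun v hv => ?_⟩
  rw [← hdist, ← hdist, ← hmin]
  exact pow_le_pow_left₀ Metric.infDist_nonneg
    (Metric.infDist_le_dist_of_mem (Submodule.mem_map_of_mem hv)) 2

/-- The zero-norm reconstruction objective
`f(v) = (1/2λ)‖y - Av‖² + ‖v‖₀`, where `‖v‖₀` is the number of nonzero entries of `v`,
attains its global minimum on `ℝ^n`. -/
theorem zero_norm_exists_minimizer
    (k n : ℕ) (A : Matrix (Fin k) (Fin n) ℝ) (y : Fin k → ℝ) (lam : ℝ) (hlam : 0 < lam)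
    (f : (Fin n → ℝ) → ℝ)
    (hf : f = fun v => (1 / (2 * lam)) * ∑ i : Fin k, (y i - A.mulVec v i) ^ 2 +
        ((Finset.univ.filter fun j : Fin n => v j ≠ 0).card : ℝ)) :
    ∃ vstar : Fin n → ℝ, ∀ v : Fin n → ℝ, f vstar ≤ f v := by
  choose w hw hmin using fun S : Finset (Fin n) =>
    A.exists_forall_sum_sq_sub_mulVec_le y
      (Submodule.pi (S : Set (Fin n))ᶜ fun _ => (⊥ : Submodule ℝ ℝ))
  simp only [Submodule.mem_pi, Set.mem_compl_iff, mem_coe, Submodule.mem_bot] at hw hmin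
  obtain ⟨S, hS⟩ := Finite.exists_min fun S : Finset (Fin n) =>
    (1 / (2 * lam)) * ∑ i, (y i - A.mulVec (w S) i) ^ 2 + (#S : ℝ)
  refine ⟨w S, fun v => ?_⟩
  have hsupp : (univ.filter fun j => w S j ≠ 0) ⊆ S := fun j hj =>
    by_contra fun hjS => (mem_filter.mp hj).2 (hw S j hjS)
  simp only [hf]
  calc
    _ ≤ (1 / (2 * lam)) * ∑ i, (y i - A.mulVec (w S) i) ^ 2 + (#S : ℝ) := by
      gcongr _ + ?_
      exact_mod_cast card_le_card hsupp
    _ ≤ _ := hS (univ.filter fun j => v j ≠ 0)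
    _ ≤ _ := by
      gcongr ?_ + _
      exact mul_le_mul_of_nonneg_left (hmin _ v (by simp)) (by positivity)
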